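/- arXiv:math/0505546 — 2 statements merged into one kernel-verified Lean document; each statement's English description precedes it below -/
import Mathlib

section
/- For n ∈ ℕ let Δ_n be the (2ⁿ+1)×(2ⁿ+1) real matrix of the Neumann probabilistic Laplacian on the path {0,…,2ⁿ}, and let R(z) = 2z(2 − z). Then for every n ≥ 0 the spectrum of Δ_n coincides, as a set, with the set of real solutions of R^{∘(n+1)}(z) = 0; that is, a real number z is an eigenvalue of Δ_n if and only if the (n+1)-fold composition of R satisfies R^{∘(n+1)}(z) = 0. -/
open Matrix

/-- The Neumann probabilistic Laplacian on the path `{0, …, 2ⁿ}`: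
`(Δ_n f)(k) = f(k) − ½f(k−1) − ½f(k+1)` for `0 < k < 2ⁿ`, with Neumann boundary rows
`(Δ_n f)(0) = f(0) − f(1)` and `(Δ_n f)(2ⁿ) = f(2ⁿ) − f(2ⁿ−1)`. -/
noncomputable def pathLap (n : ℕ) : Matrix (Fin (2 ^ n + 1)) (Fin (2 ^ n + 1)) ℝ :=
  Matrix.of fun i j =>
    if i = j then 1
    else if i.val = 0 ∧ j.val = 1 then -1
    else if i.val = 2 ^ n ∧ j.val = 2 ^ n - 1 then -1
    else if 0 < i.val ∧ i.val < 2 ^ n ∧ (j.val + 1 = i.val ∨ j.val = i.val + 1) then -(1 / 2)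
    else 0

/-- `z` is an eigenvalue of `Δ_n`. -/
def pathEig (n : ℕ) (z : ℝ) : Prop :=
  LinearMap.ker ((pathLap n - z • (1 : Matrix _ _ ℝ)).mulVecLin) ≠ ⊥

open Polynomial

/-- In the row of an interior vertex, `pathLap` acts as the second-difference operator. -/
lemma pathLap_mulVec_interior {n k : ℕ} (h₀ : 0 < k) (h : k < 2 ^ n) (g : ℕ → ℝ)
    (i : Fin (2 ^ n + 1)) (hi : i.val = k) :
    (pathLap n *ᵥ fun j => g j) i = g k - 1 / 2 * g (k - 1) - 1 / 2 * g (k + 1) := by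
  have key : ∀ j : Fin (2 ^ n + 1), pathLap n i j * g j =
      (if j = i then g j else 0) - (if j = ⟨k - 1, by omega⟩ then 1 / 2 * g j else 0)
        - (if j = ⟨k + 1, by omega⟩ then 1 / 2 * g j else 0) := by
    intro j
    simp only [pathLap, Matrix.of_apply, Fin.ext_iff, hi]
    split_ifs <;> first | (exfalso; omega) | ring
  simp [Matrix.mulVec, dotProduct, key, Finset.sum_sub_distrib, hi]

/-- The row of the left endpoint of `pathLap`. -/
lemma pathLap_mulVec_zero (n : ℕ) (g : ℕ → ℝ) (i : Fin (2 ^ n + 1)) (hi : i.val = 0) :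
    (pathLap n *ᵥ fun j => g j) i = g 0 - g 1 := by
  have hN := Nat.one_le_two_pow (n := n)
  have key : ∀ j : Fin (2 ^ n + 1), pathLap n i j * g j =
      (if j = i then g j else 0) - (if j = ⟨1, by omega⟩ then g j else 0) := by
    intro j
    simp only [pathLap, Matrix.of_apply, Fin.ext_iff, hi]
    split_ifs <;> first | (exfalso; (try simp only [true_and] at *); omega) | ring
  simp [Matrix.mulVec, dotProduct, key, Finset.sum_sub_distrib, hi]

/-- The row of the right endpoint of `pathLap`. -/
lemma pathLap_mulVec_last (n : ℕ) (g : ℕ → ℝ) (i : Fin (2 ^ n + 1)) (hi : i.val = 2 ^ n) :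
    (pathLap n *ᵥ fun j => g j) i = g (2 ^ n) - g (2 ^ n - 1) := by
  have hN := Nat.one_le_two_pow (n := n)
  have key : ∀ j : Fin (2 ^ n + 1), pathLap n i j * g j =
      (if j = i then g j else 0) - (if j = ⟨2 ^ n - 1, by omega⟩ then g j else 0) := by
    intro j
    simp only [pathLap, Matrix.of_apply, Fin.ext_iff, hi]
    split_ifs <;> first | (exfalso; (try simp only [true_and] at *); omega) | ring
  simp [Matrix.mulVec, dotProduct, key, Finset.sum_sub_distrib, hi]

lemma chebyshev_T_eval_add_two (x : ℝ) (k : ℕ) :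
    (Chebyshev.T ℝ (k + 2 : ℕ)).eval x =
      2 * x * (Chebyshev.T ℝ (k + 1 : ℕ)).eval x - (Chebyshev.T ℝ k).eval x := by
  simp [Chebyshev.T_add_two]

/-- The quadratic invariant of the Chebyshev recursion. -/
lemma chebyshev_T_eval_quadratic (x : ℝ) (k : ℕ) :
    (x * (Chebyshev.T ℝ (k + 1 : ℕ)).eval x - (Chebyshev.T ℝ k).eval x) ^ 2 =
      (x ^ 2 - 1) * ((Chebyshev.T ℝ (k + 1 : ℕ)).eval x ^ 2 - 1) := by
  induction k with
  | zero => simp; ring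
  | succ k ih =>
    rw [chebyshev_T_eval_add_two]
    linear_combination ih

lemma chebyshev_T_eval_sq_of_sq_eq_one {x : ℝ} (hx : x ^ 2 = 1) (k : ℕ) :
    (Chebyshev.T ℝ k).eval x ^ 2 = 1 := by
  rcases sq_eq_sq_iff_eq_or_eq_neg.mp (hx.trans (one_pow 2).symm) with rfl | rfl
  · simp
  · simp [neg_one_pow_eq_or]

/-- The Neumann condition at the endpoint `k + 1` for the Chebyshev sequence. -/
lemma chebyshev_T_eval_neumann_iff (x : ℝ) (k : ℕ) :
    x * (Chebyshev.T ℝ (k + 1 : ℕ)).eval x = (Chebyshev.T ℝ k).eval x ↔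
      (Chebyshev.T ℝ (k + 1 : ℕ)).eval x ^ 2 = 1 := by
  have hq := chebyshev_T_eval_quadratic x k
  constructor
  · intro h
    rw [h, sub_self, zero_pow two_ne_zero, eq_comm, mul_eq_zero] at hq
    rcases hq with hx | hT
    · exact chebyshev_T_eval_sq_of_sq_eq_one (sub_eq_zero.mp hx) _
    · exact sub_eq_zero.mp hT
  · intro h
    rw [h, sub_self, mul_zero] at hq
    exact sub_eq_zero.mp (pow_eq_zero_iff two_ne_zero |>.mp hq)

/-- The substitution `x = 1 - z` conjugates `z ↦ 2z(2 - z)` to the Chebyshev polynomial `T₂`. -/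
lemma one_sub_iterate_eq_chebyshev_T (m : ℕ) (z : ℝ) :
    1 - (fun w : ℝ => 2 * w * (2 - w))^[m] z = (Chebyshev.T ℝ (2 ^ m : ℕ)).eval (1 - z) := by
  induction m with
  | zero => simp
  | succ m ih =>
    have hT : Chebyshev.T ℝ ((2 ^ (m + 1) : ℕ) : ℤ) =
        (Chebyshev.T ℝ 2).comp (Chebyshev.T ℝ ((2 ^ m : ℕ) : ℤ)) := by
      rw [← Chebyshev.T_mul]
      congr 1
      push_cast
      ring
    rw [Function.iterate_succ_apply', hT, eval_comp, ← ih, Chebyshev.T_two]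
    simp
    ring

lemma iterate_eq_zero_iff_chebyshev_T_sq (n : ℕ) (z : ℝ) :
    (fun w : ℝ => 2 * w * (2 - w))^[n + 1] z = 0 ↔
      (Chebyshev.T ℝ (2 ^ n : ℕ)).eval (1 - z) ^ 2 = 1 := by
  rw [← one_sub_iterate_eq_chebyshev_T, Function.iterate_succ_apply']
  constructor <;> intro h
  · linear_combination -(1 / 2) * h
  · linear_combination -2 * h

/-- A solution of the eigenvalue recursion with the left Neumann condition is a multiple of the
Chebyshev sequence. -/
lemma eq_mul_chebyshev_T_of_recurrence {N : ℕ} {x : ℝ} {g : ℕ → ℝ} (h₁ : g 1 = x * g 0)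
    (h : ∀ k, k + 1 < N → g (k + 2) = 2 * x * g (k + 1) - g k) (k : ℕ) (hk : k + 1 ≤ N) :
    g k = g 0 * (Chebyshev.T ℝ k).eval x ∧
      g (k + 1) = g 0 * (Chebyshev.T ℝ (k + 1 : ℕ)).eval x := by
  induction k with
  | zero => simp [h₁, mul_comm]
  | succ k ih =>
    obtain ⟨ha, hb⟩ := ih (by omega)
    refine ⟨hb, ?_⟩
    rw [chebyshev_T_eval_add_two, h k (by omega), ha, hb]
    ring

lemma pathEig_iff_exists_mulVec (n : ℕ) (z : ℝ) :
    pathEig n z ↔ ∃ f : Fin (2 ^ n + 1) → ℝ, f ≠ 0 ∧ pathLap n *ᵥ f = z • f := by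
  simp [pathEig, Submodule.ne_bot_iff, sub_eq_zero, and_comm]

/-- The eigenvalue equation for `pathLap`, written row by row. -/
lemma pathLap_mulVec_eq_smul_iff (n : ℕ) (z : ℝ) (g : ℕ → ℝ) :
    (pathLap n *ᵥ fun j => g j) = z • (fun j : Fin (2 ^ n + 1) => g j) ↔
      g 1 = (1 - z) * g 0 ∧
      (∀ k, k + 1 < 2 ^ n → g (k + 2) = 2 * (1 - z) * g (k + 1) - g k) ∧
      (1 - z) * g (2 ^ n) = g (2 ^ n - 1) := by
  constructor
  · intro h
    refine ⟨?_, fun k hk => ?_, ?_⟩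
    · have := congrFun h ⟨0, Nat.succ_pos _⟩
      rw [pathLap_mulVec_zero n g _ rfl] at this
      simp only [Pi.smul_apply, smul_eq_mul] at this
      linear_combination -this
    · have := congrFun h ⟨k + 1, by omega⟩
      rw [pathLap_mulVec_interior (by omega) hk g _ rfl] at this
      simp only [Pi.smul_apply, smul_eq_mul, Nat.add_sub_cancel] at this
      linear_combination -2 * this
    · have := congrFun h ⟨2 ^ n, by omega⟩
      rw [pathLap_mulVec_last n g _ rfl] at this
      simp only [Pi.smul_apply, smul_eq_mul] at this
      linear_combination this
  · rintro ⟨h₀, hm, hl⟩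
    ext ⟨i, hi⟩
    simp only [Pi.smul_apply, smul_eq_mul]
    rcases Nat.eq_zero_or_pos i with rfl | hpos
    · rw [pathLap_mulVec_zero n g _ rfl]
      linear_combination -h₀
    · rcases (Nat.lt_succ_iff.mp hi).eq_or_lt with rfl | hlt
      · rw [pathLap_mulVec_last n g _ rfl]
        linear_combination hl
      · obtain ⟨k, rfl⟩ := Nat.exists_eq_add_of_le' hpos
        rw [pathLap_mulVec_interior hpos hlt g _ rfl, Nat.add_sub_cancel]
        linear_combination -(1 / 2) * hm k hlt

lemma pathEig_iff_chebyshev_T_neumann (n : ℕ) (z : ℝ) :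
    pathEig n z ↔ (1 - z) * (Chebyshev.T ℝ (2 ^ n : ℕ)).eval (1 - z) =
      (Chebyshev.T ℝ (2 ^ n - 1 : ℕ)).eval (1 - z) := by
  have hN : 2 ^ n - 1 + 1 = 2 ^ n := Nat.sub_add_cancel Nat.one_le_two_pow
  rw [pathEig_iff_exists_mulVec]
  constructor
  · rintro ⟨f, hf, hev⟩
    obtain ⟨g, rfl⟩ : ∃ g : ℕ → ℝ, f = fun j : Fin (2 ^ n + 1) => g j :=
      ⟨fun k => f (Fin.ofNat _ k), by ext j; simp⟩
    obtain ⟨h₀, hm, hl⟩ := (pathLap_mulVec_eq_smul_iff n z g).mp hev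
    have hT := eq_mul_chebyshev_T_of_recurrence h₀ hm
    have hg : g 0 ≠ 0 := by
      intro hg
      apply hf
      ext ⟨i, hi⟩
      rcases (Nat.lt_succ_iff.mp hi).eq_or_lt with rfl | hlt
      · have := (hT (2 ^ n - 1) hN.le).2
        rw [hN, hg, zero_mul] at this
        exact this
      · have := (hT i hlt).1
        rw [hg, zero_mul] at this
        exact this
    obtain ⟨ha, hb⟩ := hT (2 ^ n - 1) hN.le
    rw [hN] at hb
    rw [ha, hb] at hl
    exact mul_left_cancel₀ hg (by linear_combination hl)
  · intro h
    refine ⟨fun j => (Chebyshev.T ℝ (j : ℕ)).eval (1 - z), fun h0 => ?_, ?_⟩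
    · simpa using congrFun h0 0
    · exact (pathLap_mulVec_eq_smul_iff n z fun k => (Chebyshev.T ℝ k).eval (1 - z)).mpr
        ⟨by simp, fun k _ => chebyshev_T_eval_add_two _ k, h⟩

theorem path_laplacian_spectrum_eq_iterated_preimages_of_zero :
    ∀ n : ℕ, ∀ z : ℝ,
      pathEig n z ↔ (fun w : ℝ => 2 * w * (2 - w))^[n + 1] z = 0 := by
  intro n z
  have h := chebyshev_T_eval_neumann_iff (1 - z) (2 ^ n - 1)
  rw [Nat.sub_add_cancel Nat.one_le_two_pow] at h
  rw [pathEig_iff_chebyshev_T_neumann, h, iterate_eq_zero_iff_chebyshev_T_sq]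
end

section
/- Fix 0 < p < 1 and set q = 1 − p, and let Δ_{p,n} be the (3ⁿ+1)×(3ⁿ+1) Neumann random-walk Laplacian matrices defined via the substitution sequences S_n, and R_p(z) = z(z² + 3z + 2 + pq)/(pq). Then for every n ≥ 1 the spectrum of Δ_{p,n} equals, as a set of real numbers, {0, −2} ∪ ⋃_{m=0}^{n−1} {z ∈ ℝ : R_p^{∘m}(z) = −1+q or R_p^{∘m}(z) = −1−q}. In particular 0, −1+q, −1−q, −2 are eigenvalues of Δ_{p,n} for all n ≥ 1; moreover, for n ≥ 1 the numbers −1+p and −1−p are eigenvalues of Δ_{p,n} if and only if p = q (i.e., p = 1/2). -/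
open Matrix

/-- The substitution sequences `S_n` over `{p, q}`: `S_0 = ()` and
`S_{n+1} = S_n ⌢ (p) ⌢ S_n ⌢ (q) ⌢ S_n`. -/
def subSeq (p q : ℝ) : ℕ → List ℝ
  | 0 => []
  | n + 1 => subSeq p q n ++ [p] ++ subSeq p q n ++ [q] ++ subSeq p q n

/-- The Neumann random-walk Laplacian on `{0, …, 3ⁿ}`:
`(Δ_{p,n} f)(k) = (1 − s_k)f(k−1) + s_k f(k+1) − f(k)` for `0 < k < 3ⁿ`, where `s_k` is the
`k`-th entry of `S_n`, with Neumann boundary rows `(Δ_{p,n} f)(0) = f(1) − f(0)` and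
`(Δ_{p,n} f)(3ⁿ) = f(3ⁿ−1) − f(3ⁿ)`. -/
noncomputable def fracLap (p : ℝ) (n : ℕ) : Matrix (Fin (3 ^ n + 1)) (Fin (3 ^ n + 1)) ℝ :=
  Matrix.of fun i j =>
    if i = j then -1
    else if i.val = 0 ∧ j.val = 1 then 1
    else if i.val = 3 ^ n ∧ j.val = 3 ^ n - 1 then 1
    else if 0 < i.val ∧ i.val < 3 ^ n ∧ j.val = i.val + 1 then
      (subSeq p (1 - p) n).getD (i.val - 1) 0
    else if 0 < i.val ∧ i.val < 3 ^ n ∧ j.val + 1 = i.val then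
      1 - (subSeq p (1 - p) n).getD (i.val - 1) 0
    else 0

/-- `z` is an eigenvalue of `Δ_{p,n}`. -/
def fracEig (p : ℝ) (n : ℕ) (z : ℝ) : Prop :=
  LinearMap.ker ((fracLap p n - z • (1 : Matrix _ _ ℝ)).mulVecLin) ≠ ⊥

/-- The cubic polynomial `R_p(z) = z(z² + 3z + 2 + pq)/(pq)`, `q = 1 − p`. -/
noncomputable def Rp (p : ℝ) (z : ℝ) : ℝ :=
  z * (z ^ 2 + 3 * z + 2 + p * (1 - p)) / (p * (1 - p))

/-- Solving `w f(k) = (1 - s) f(k-1) + s f(k+1)` for `f(k+1)`: the pair `(f(k-1), f(k))` is sent to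
`(f(k), f(k+1))`. -/
noncomputable def transferStep (w : ℝ) (x : ℝ × ℝ) (s : ℝ) : ℝ × ℝ :=
  (x.2, (w * x.2 - (1 - s) * x.1) / s)

/-- The solution of the three-term recursion with jump probabilities `l` that satisfies the left
Neumann condition also satisfies the right one. -/
def NeumannSolvable (w : ℝ) (l : List ℝ) : Prop :=
  (l.foldl (transferStep w) (1, w)).1 = w * (l.foldl (transferStep w) (1, w)).2

/-- The pairs `(f(k), f(k+1))` of the solution of the three-term recursion with jump
probabilities `s`, started from `(1, w)`. -/
noncomputable def transferOrbit (w : ℝ) (s : ℕ → ℝ) : ℕ → ℝ × ℝ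
  | 0 => (1, w)
  | k + 1 => transferStep w (transferOrbit w s k) (s k)

/-- Insertion of `p, q` in every gap of a list, including both ends. -/
def refineSeq (p q : ℝ) : List ℝ → List ℝ
  | [] => [p, q]
  | s :: l => p :: q :: s :: refineSeq p q l

theorem refineSeq_append (p q s : ℝ) (l₁ l₂ : List ℝ) :
    refineSeq p q (l₁ ++ s :: l₂) = refineSeq p q l₁ ++ s :: refineSeq p q l₂ := by
  induction l₁ with
  | nil => simp [refineSeq]
  | cons a l ih => simp [refineSeq, ih]

theorem subSeq_succ_eq_refineSeq (p q : ℝ) (n : ℕ) :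
    subSeq p q (n + 1) = refineSeq p q (subSeq p q n) := by
  induction n with
  | zero => simp [subSeq, refineSeq]
  | succ n ih =>
    conv_rhs => rw [subSeq]
    simp only [List.append_assoc, List.cons_append, List.nil_append, refineSeq_append, ← ih]
    rw [subSeq]
    simp

theorem length_subSeq (p q : ℝ) (n : ℕ) : (subSeq p q n).length + 1 = 3 ^ n := by
  induction n with
  | zero => simp [subSeq]
  | succ n ih => simp only [subSeq, List.length_append, List.length_singleton, pow_succ]; omega

theorem mem_subSeq {p q s : ℝ} {n : ℕ} (hs : s ∈ subSeq p q n) : s = p ∨ s = q := by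
  induction n with
  | zero => simp [subSeq] at hs
  | succ n ih =>
    simp only [subSeq, List.mem_append, List.mem_singleton] at hs
    tauto

theorem foldl_transferStep_eq_orbit (w : ℝ) (l : List ℝ) (d : ℝ) :
    l.foldl (transferStep w) (1, w) = transferOrbit w (fun k => l.getD k d) l.length := by
  have key : ∀ k ≤ l.length, (l.take k).foldl (transferStep w) (1, w) =
      transferOrbit w (fun k => l.getD k d) k := by
    intro k
    induction k with
    | zero => simp [transferOrbit]
    | succ k ih =>
      intro hk
      have hk' : k < l.length := hk
      rw [List.take_add_one, List.foldl_append, ih (by omega)]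
      simp [transferOrbit, hk']
  simpa using key l.length le_rfl

theorem foldl_refineSeq {p w W : ℝ} (hp : p ≠ 0) (hq : 1 - p ≠ 0)
    (hW : p * (1 - p) * W = w * (w ^ 2 - p ^ 2 - (1 - p))) (l : List ℝ) (hl : ∀ s ∈ l, s ≠ 0)
    (a b G : ℝ) (h : (w ^ 2 - p ^ 2) * b = w * (1 - p) * a + p * (1 - p) * G) :
    ((refineSeq p (1 - p) l).foldl (transferStep w) (a, b)).2 =
        (l.foldl (transferStep W) (a, G)).2 ∧
      (w ^ 2 - p ^ 2) * ((refineSeq p (1 - p) l).foldl (transferStep w) (a, b)).1 =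
        p * (1 - p) * (l.foldl (transferStep W) (a, G)).1 +
          w * (1 - p) * (l.foldl (transferStep W) (a, G)).2 := by
  have h3 : ∀ a b G : ℝ, (w ^ 2 - p ^ 2) * b = w * (1 - p) * a + p * (1 - p) * G →
      (w * ((w * b - (1 - p) * a) / p) - (1 - (1 - p)) * b) / (1 - p) = G := by
    intro a b G h
    field_simp
    linear_combination h
  have h2 : ∀ a b G : ℝ, (w ^ 2 - p ^ 2) * b = w * (1 - p) * a + p * (1 - p) * G →
      (w ^ 2 - p ^ 2) * ((w * b - (1 - p) * a) / p) = p * (1 - p) * a + w * (1 - p) * G := by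
    intro a b G h
    field_simp
    linear_combination w * h
  induction l generalizing a b G with
  | nil =>
    simp only [refineSeq, List.foldl_cons, List.foldl_nil, transferStep]
    exact ⟨h3 a b G h, h2 a b G h⟩
  | cons s l ih =>
    have hs : s ≠ 0 := hl s (by simp)
    simp only [refineSeq, List.foldl_cons, transferStep, h3 a b G h]
    refine ih (fun t ht => hl t (by simp [ht])) _ _ _ ?_
    have hf := h2 a b G h
    generalize (w * b - (1 - p) * a) / p = f at hf ⊢
    field_simp
    linear_combination -G * hW - (1 - s) * hf

theorem neumannSolvable_refineSeq {p w W : ℝ} (hp : p ≠ 0) (hq : 1 - p ≠ 0)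
    (hw : w ^ 2 - p ^ 2 ≠ 0) (hW : p * (1 - p) * W = w * (w ^ 2 - p ^ 2 - (1 - p)))
    (l : List ℝ) (hl : ∀ s ∈ l, s ≠ 0) :
    NeumannSolvable w (refineSeq p (1 - p) l) ↔ NeumannSolvable W l := by
  obtain ⟨h2, h1⟩ := foldl_refineSeq hp hq hW l hl 1 w W (by linear_combination -hW)
  unfold NeumannSolvable
  rw [h2]
  set x := l.foldl (transferStep W) (1, W)
  set y := (refineSeq p (1 - p) l).foldl (transferStep w) (1, w)
  have hpq : p * (1 - p) ≠ 0 := mul_ne_zero hp hq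
  constructor
  · intro h
    apply mul_left_cancel₀ hpq
    rw [h] at h1
    linear_combination -h1 - x.2 * hW
  · intro h
    apply mul_left_cancel₀ hw
    rw [h1]
    linear_combination p * (1 - p) * h + x.2 * hW

/-- At the exceptional values `w = ±p`, the step of the ratio `f(3k+1) / f(3k)` (up to sign) across
a coarse node. -/
noncomputable def ratioStep (p x s : ℝ) : ℝ := (p + (1 - s) * (x - (1 - p) / p)) / s

theorem foldl_refineSeq_exceptional {p e : ℝ} (hp : p ≠ 0) (hq : 1 - p ≠ 0) (he : e ^ 2 = 1)
    (l : List ℝ) (hl : ∀ s ∈ l, s ≠ 0) (a x : ℝ) (ha : a ≠ 0) :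
    ∃ c : ℝ, c ≠ 0 ∧ (refineSeq p (1 - p) l).foldl (transferStep (e * p)) (a, e * x * a) =
      (c * (l.foldl (ratioStep p) x - (1 - p) / p), -e * c) := by
  have h2 : ∀ a x : ℝ, (e * p * (e * x * a) - (1 - p) * a) / p = a * (x - (1 - p) / p) := by
    intro a x
    field_simp
    linear_combination p * x * a * he
  have h3 : ∀ a x : ℝ, (e * p * (a * (x - (1 - p) / p)) - (1 - (1 - p)) * (e * x * a)) / (1 - p)
      = -e * a := by
    intro a x
    field_simp
    ring
  induction l generalizing a x with
  | nil =>
    simp only [refineSeq, List.foldl_cons, List.foldl_nil, transferStep]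
    exact ⟨a, ha, by rw [h2, h3]⟩
  | cons s l ih =>
    have hs : s ≠ 0 := hl s (by simp)
    have he0 : e ≠ 0 := by rintro rfl; norm_num at he
    obtain ⟨c, hc, h⟩ := ih (fun t ht => hl t (by simp [ht])) (-e * a) (ratioStep p x s)
      (mul_ne_zero (neg_ne_zero.2 he0) ha)
    refine ⟨c, hc, ?_⟩
    rw [List.foldl_cons, ← h]
    simp only [refineSeq, List.foldl_cons, transferStep, h2, h3]
    congr 2
    unfold ratioStep
    field_simp
    linear_combination -(1 - p + p * s + p * s * x - p * x - s) * he

theorem foldl_ratioStep_subSeq {p : ℝ} (hp0 : 0 < p) (hp1 : p < 1) (n : ℕ) :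
    ∃ c : ℝ, 0 ≤ c ∧ ∀ x, (subSeq p (1 - p) n).foldl (ratioStep p) x = x - c * (1 - 2 * p) := by
  have hq : 0 < 1 - p := by linarith
  induction n with
  | zero => exact ⟨0, le_rfl, by simp [subSeq]⟩
  | succ n ih =>
    obtain ⟨c, hc, h⟩ := ih
    refine ⟨c * (2 + p / (1 - p)) + (1 + p) / (p * (1 - p)), by positivity, fun x => ?_⟩
    simp only [subSeq, List.foldl_append, List.foldl_cons, List.foldl_nil, h, ratioStep]
    field_simp
    ring

theorem neumannSolvable_exceptional {p e : ℝ} (hp0 : 0 < p) (hp1 : p < 1) (he : e ^ 2 = 1)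
    (n : ℕ) : NeumannSolvable (e * p) (subSeq p (1 - p) (n + 1)) ↔ p = 1 - p := by
  have hq : 0 < 1 - p := by linarith
  have hl : ∀ s ∈ subSeq p (1 - p) n, s ≠ 0 := fun s hs => by
    rcases mem_subSeq hs with rfl | rfl
    exacts [hp0.ne', hq.ne']
  obtain ⟨a, ha, h⟩ := foldl_refineSeq_exceptional hp0.ne' hq.ne' he _ hl 1 p one_ne_zero
  obtain ⟨c, hc, hx⟩ := foldl_ratioStep_subSeq hp0 hp1 n
  rw [mul_one, hx, ← subSeq_succ_eq_refineSeq] at h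
  rw [NeumannSolvable, h]
  have key : a * (p - c * (1 - 2 * p) - (1 - p) / p) - e * p * (-e * a) =
      a * ((2 * p - 1) * (c + (1 + p) / p)) := by
    field_simp
    linear_combination p ^ 2 * he
  rw [← sub_eq_zero]
  dsimp only
  rw [key]
  have : c + (1 + p) / p ≠ 0 := by positivity
  simp only [mul_eq_zero, ha, this, false_or, or_false]
  constructor <;> intro h <;> linarith

theorem fracLap_mulVec_zero (p : ℝ) (n : ℕ) (F : ℕ → ℝ) :
    (fracLap p n *ᵥ fun i => F i.val) 0 = F 1 - F 0 := by
  have hN : 0 < 3 ^ n := by positivity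
  obtain ⟨g, hg⟩ : ∃ g : ℕ → ℝ, g = fun j =>
    (if j = 0 then -F 0 else 0) + (if j = 1 then F 1 else 0) := ⟨_, rfl⟩
  have e : ∀ j : Fin (3 ^ n + 1), fracLap p n 0 j * F j.val = g j.val := by
    intro j
    simp only [fracLap, Matrix.of_apply, Fin.ext_iff, Fin.val_zero, hg]
    by_cases h0 : j.val = 0
    · simp [h0]
    by_cases h1 : j.val = 1
    · simp [h1]
    simp [h0, h1, Ne.symm h0, hN.ne]
  simp only [Matrix.mulVec, dotProduct]
  rw [Finset.sum_congr rfl fun j _ => e j, Fin.sum_univ_eq_sum_range g, hg]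
  simp [Finset.sum_add_distrib, hN]
  ring

theorem fracLap_mulVec_last (p : ℝ) (n : ℕ) (F : ℕ → ℝ) :
    (fracLap p n *ᵥ fun i => F i.val) (Fin.last _) = F (3 ^ n - 1) - F (3 ^ n) := by
  have hN : 0 < 3 ^ n := by positivity
  obtain ⟨g, hg⟩ : ∃ g : ℕ → ℝ, g = fun j =>
    (if j = 3 ^ n then -F (3 ^ n) else 0) +
      (if j = 3 ^ n - 1 then F (3 ^ n - 1) else 0) := ⟨_, rfl⟩
  have e : ∀ j : Fin (3 ^ n + 1), fracLap p n (Fin.last _) j * F j.val = g j.val := by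
    intro j
    simp only [fracLap, Matrix.of_apply, Fin.ext_iff, Fin.val_last, hg]
    rcases eq_or_ne j.val (3 ^ n) with h | h
    · have h' : ¬ (3 ^ n = 3 ^ n - 1) := by omega
      simp [h, h']
    · by_cases h2 : j.val = 3 ^ n - 1
      · have h' : ¬ (3 ^ n = 3 ^ n - 1) := by omega
        simp [h2, h', Ne.symm h']
      · simp [h, h2, Ne.symm h]
  simp only [Matrix.mulVec, dotProduct]
  rw [Finset.sum_congr rfl fun j _ => e j, Fin.sum_univ_eq_sum_range g, hg]
  have : 3 ^ n - 1 < 3 ^ n + 1 := by omega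
  simp [Finset.sum_add_distrib, this]
  ring

theorem fracLap_mulVec_interior (p : ℝ) (n : ℕ) (F : ℕ → ℝ) (k : ℕ) (hk : k + 1 < 3 ^ n) :
    (fracLap p n *ᵥ fun i => F i.val) ⟨k + 1, by omega⟩ =
      (1 - (subSeq p (1 - p) n).getD k 0) * F k + (subSeq p (1 - p) n).getD k 0 * F (k + 2)
        - F (k + 1) := by
  set s := (subSeq p (1 - p) n).getD k 0 with hs
  obtain ⟨g, hg⟩ : ∃ g : ℕ → ℝ, g = fun j =>
    (if j = k + 1 then -F (k + 1) else 0) + (if j = k + 2 then s * F (k + 2) else 0) +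
      (if j = k then (1 - s) * F k else 0) := ⟨_, rfl⟩
  have e : ∀ j : Fin (3 ^ n + 1), fracLap p n ⟨k + 1, by omega⟩ j * F j.val = g j.val := by
    intro j
    have h'' : k ≠ k + 1 + 1 := by omega
    have h' : k + 1 ≠ 3 ^ n := by omega
    simp only [fracLap, Matrix.of_apply, Fin.ext_iff, add_tsub_cancel_right, ← hs, hg]
    by_cases h1 : j.val = k + 1
    · simp [h1]
    by_cases h2 : j.val = k + 2
    · simp [h2, h', hk]
    by_cases h3 : j.val = k
    · simp [h3, h', h'', hk]
    simp [h1, h2, h3, h', Ne.symm h1]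
  simp only [Matrix.mulVec, dotProduct]
  rw [Finset.sum_congr rfl fun j _ => e j, Fin.sum_univ_eq_sum_range g, hg]
  have h1 : k < 3 ^ n := by omega
  have h2 : k < 3 ^ n + 1 := by omega
  have h3 : k + 2 < 3 ^ n + 1 := by omega
  simp [Finset.sum_add_distrib, h1, h2, h3]
  ring

theorem fracLap_mulVec_eq_smul_iff (p : ℝ) (n : ℕ) (z : ℝ) (F : ℕ → ℝ) :
    (fracLap p n *ᵥ fun i => F i.val) = z • (fun i => F i.val) ↔
      F 1 = (z + 1) * F 0 ∧ F (3 ^ n - 1) = (z + 1) * F (3 ^ n) ∧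
      ∀ k, k + 1 < 3 ^ n → (z + 1) * F (k + 1) =
        (1 - (subSeq p (1 - p) n).getD k 0) * F k +
          (subSeq p (1 - p) n).getD k 0 * F (k + 2) := by
  constructor
  · intro h
    refine ⟨?_, ?_, fun k hk => ?_⟩
    · have := congrFun h 0
      rw [fracLap_mulVec_zero] at this
      simp at this
      linarith
    · have := congrFun h (Fin.last _)
      rw [fracLap_mulVec_last] at this
      simp at this
      linarith
    · have := congrFun h ⟨k + 1, by omega⟩
      rw [fracLap_mulVec_interior p n F k hk] at this
      simp only [Pi.smul_apply, smul_eq_mul] at this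
      linarith
  · rintro ⟨h0, hN, hk⟩
    ext i
    obtain ⟨i, hi⟩ := i
    rcases Nat.eq_zero_or_pos i with rfl | hi0
    · have := fracLap_mulVec_zero p n F
      simp only [Fin.zero_eta, Pi.smul_apply, smul_eq_mul, Fin.val_zero] at this ⊢
      linarith
    · rcases Nat.lt_succ_iff_lt_or_eq.1 hi with hi | rfl
      · obtain ⟨k, rfl⟩ : ∃ k, i = k + 1 := ⟨i - 1, by omega⟩
        rw [fracLap_mulVec_interior p n F k hi]
        simp only [Pi.smul_apply, smul_eq_mul]
        linarith [hk k hi]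
      · have := fracLap_mulVec_last p n F
        simp only [Fin.last] at this
        rw [this]
        simp only [Pi.smul_apply, smul_eq_mul]
        linarith

theorem fracEig_iff_exists (p : ℝ) (n : ℕ) (z : ℝ) :
    fracEig p n z ↔ ∃ v : Fin (3 ^ n + 1) → ℝ, v ≠ 0 ∧ fracLap p n *ᵥ v = z • v := by
  rw [fracEig, Submodule.ne_bot_iff]
  simp only [LinearMap.mem_ker, Matrix.mulVecLin_apply, Matrix.sub_mulVec, Matrix.smul_mulVec,
    Matrix.one_mulVec, sub_eq_zero]
  exact exists_congr fun v => and_comm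

theorem fracEig_iff_neumannSolvable {p : ℝ} (hp0 : 0 < p) (hp1 : p < 1) (n : ℕ) (z : ℝ) :
    fracEig p n z ↔ NeumannSolvable (z + 1) (subSeq p (1 - p) n) := by
  have hlen := length_subSeq p (1 - p) n
  have hs : ∀ k, k + 1 < 3 ^ n → (subSeq p (1 - p) n).getD k 0 ≠ 0 := fun k hk => by
    have hk' : k < (subSeq p (1 - p) n).length := by omega
    rw [List.getD_eq_getElem _ _ hk']
    rcases mem_subSeq (List.getElem_mem hk') with h | h <;> rw [h]
    exacts [hp0.ne', (sub_pos.2 hp1).ne']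
  rw [fracEig_iff_exists, NeumannSolvable, foldl_transferStep_eq_orbit _ _ 0]
  set L := (subSeq p (1 - p) n).length
  set s : ℕ → ℝ := fun k => (subSeq p (1 - p) n).getD k 0 with hs_def
  have hL : 3 ^ n - 1 = L := by omega
  constructor
  · rintro ⟨v, hv0, hv⟩
    obtain ⟨F, rfl⟩ : ∃ F : ℕ → ℝ, v = fun i => F i.val :=
      ⟨fun k => if h : k < 3 ^ n + 1 then v ⟨k, h⟩ else 0, by ext i; simp [i.isLt]⟩
    rw [fracLap_mulVec_eq_smul_iff, hL, ← hlen] at hv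
    obtain ⟨h0, hN, hk⟩ := hv
    have key : ∀ k ≤ L, F k = F 0 * (transferOrbit (z + 1) s k).1 ∧
        F (k + 1) = F 0 * (transferOrbit (z + 1) s k).2 := by
      intro k
      induction k with
      | zero => intro _; simp [transferOrbit, h0, mul_comm]
      | succ k ih =>
        intro hkL
        obtain ⟨i1, i2⟩ := ih (by omega)
        have hsk : s k ≠ 0 := hs k (by omega)
        have := hk k (by omega)
        refine ⟨i2, ?_⟩
        simp only [transferOrbit, transferStep]
        rw [← mul_div_assoc, eq_div_iff hsk]
        simp only [hs_def] at i1 i2 ⊢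
        rw [i2, i1] at this
        linear_combination -this
    have hF0 : F 0 ≠ 0 := by
      intro hF
      apply hv0
      ext i
      obtain ⟨i, hi⟩ := i
      rcases Nat.lt_or_ge L i with h | h
      · have : i = L + 1 := by omega
        simp [this, (key L le_rfl).2, hF]
      · simp [(key i h).1, hF]
    apply mul_left_cancel₀ hF0
    linear_combination hN - (key L le_rfl).1 + (z + 1) * (key L le_rfl).2
  · intro h
    refine ⟨fun i => (transferOrbit (z + 1) s i.val).1, fun h0 => ?_, ?_⟩
    · simpa [transferOrbit] using congrFun h0 0
    · rw [fracLap_mulVec_eq_smul_iff p n z fun k => (transferOrbit (z + 1) s k).1, hL, ← hlen]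
      refine ⟨by simp [transferOrbit, transferStep], h, fun k hk => ?_⟩
      have hsk : s k ≠ 0 := hs k (by omega)
      simp only [transferOrbit, transferStep]
      change _ = (1 - s k) * _ + s k * _
      field_simp
      ring

theorem Rp_eq_zero_iff {p : ℝ} (hp0 : 0 < p) (hp1 : p < 1) (z : ℝ) :
    Rp p z = 0 ↔ z = 0 ∨ z = -1 - p ∨ z = -1 - (1 - p) := by
  have hpq : p * (1 - p) ≠ 0 := mul_ne_zero hp0.ne' (sub_pos.2 hp1).ne'
  have e : z * (z ^ 2 + 3 * z + 2 + p * (1 - p)) =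
      z * ((z - (-1 - p)) * (z - (-1 - (1 - p)))) := by ring
  rw [Rp, div_eq_zero_iff, or_iff_left hpq, e]
  simp only [mul_eq_zero, sub_eq_zero]

theorem Rp_eq_neg_two_iff {p : ℝ} (hp0 : 0 < p) (hp1 : p < 1) (z : ℝ) :
    Rp p z = -2 ↔ z = -2 ∨ z = -1 + p ∨ z = -1 + (1 - p) := by
  have hpq : p * (1 - p) ≠ 0 := mul_ne_zero hp0.ne' (sub_pos.2 hp1).ne'
  have e : z * (z ^ 2 + 3 * z + 2 + p * (1 - p)) - -2 * (p * (1 - p)) =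
      (z - -2) * ((z - (-1 + p)) * (z - (-1 + (1 - p)))) := by ring
  rw [Rp, div_eq_iff hpq, ← sub_eq_zero, e]
  simp only [mul_eq_zero, sub_eq_zero]

theorem fracEig_succ_iff {p : ℝ} (hp0 : 0 < p) (hp1 : p < 1) (n : ℕ) {z : ℝ}
    (hz1 : z ≠ -1 + p) (hz2 : z ≠ -1 - p) : fracEig p (n + 1) z ↔ fracEig p n (Rp p z) := by
  have hq : 0 < 1 - p := by linarith
  rw [fracEig_iff_neumannSolvable hp0 hp1, fracEig_iff_neumannSolvable hp0 hp1,
    subSeq_succ_eq_refineSeq]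
  refine neumannSolvable_refineSeq hp0.ne' hq.ne' ?_ ?_ _ fun s hs => ?_
  · have : (z + 1) ^ 2 - p ^ 2 = (z - (-1 + p)) * (z - (-1 - p)) := by ring
    rw [this]
    exact mul_ne_zero (sub_ne_zero.2 hz1) (sub_ne_zero.2 hz2)
  · unfold Rp
    field_simp
    ring
  · rcases mem_subSeq hs with rfl | rfl
    exacts [hp0.ne', hq.ne']

theorem fracEig_succ_exceptional {p : ℝ} (hp0 : 0 < p) (hp1 : p < 1) (n : ℕ) {z : ℝ}
    (hz : z = -1 + p ∨ z = -1 - p) : fracEig p (n + 1) z ↔ p = 1 - p := by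
  rw [fracEig_iff_neumannSolvable hp0 hp1]
  rcases hz with rfl | rfl
  · rw [← neumannSolvable_exceptional hp0 hp1 (e := 1) (by norm_num) n]
    ring_nf
  · rw [← neumannSolvable_exceptional hp0 hp1 (e := -1) (by norm_num) n]
    ring_nf

theorem fracEig_iff {p : ℝ} (hp0 : 0 < p) (hp1 : p < 1) (n : ℕ) (z : ℝ) :
    fracEig p n z ↔
      (z = 0 ∨ z = -2 ∨ ∃ m < n, (Rp p)^[m] z = -1 + (1 - p) ∨ (Rp p)^[m] z = -1 - (1 - p)) := by
  have R0 : Rp p 0 = 0 := (Rp_eq_zero_iff hp0 hp1 0).2 (by simp)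
  have R2 : Rp p (-2) = -2 := (Rp_eq_neg_two_iff hp0 hp1 _).2 (by simp)
  induction n generalizing z with
  | zero =>
    rw [fracEig_iff_neumannSolvable hp0 hp1]
    simp only [NeumannSolvable, subSeq, List.foldl_nil, not_lt_zero, false_and, exists_false,
      or_false]
    have : z = 0 ∨ z = -2 ↔ z * (z + 2) = 0 := by
      rw [mul_eq_zero, add_eq_zero_iff_eq_neg]
    rw [this]
    constructor <;> intro h <;> linarith
  | succ n ih =>
    have hsplit : (∃ m < n + 1, (Rp p)^[m] z = -1 + (1 - p) ∨ (Rp p)^[m] z = -1 - (1 - p)) ↔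
        (z = -1 + (1 - p) ∨ z = -1 - (1 - p)) ∨
        ∃ m < n, (Rp p)^[m] (Rp p z) = -1 + (1 - p) ∨ (Rp p)^[m] (Rp p z) = -1 - (1 - p) := by
      constructor
      · rintro ⟨m, hm, h⟩
        cases m with
        | zero => exact Or.inl h
        | succ m => exact Or.inr ⟨m, by omega, h⟩
      · rintro (h | ⟨m, hm, h⟩)
        · exact ⟨0, by omega, h⟩
        · exact ⟨m + 1, by omega, h⟩
    rw [hsplit]
    by_cases hz : z = -1 + p ∨ z = -1 - p
    · rw [fracEig_succ_exceptional hp0 hp1 n hz]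
      have hR : Rp p z = 0 ∨ Rp p z = -2 := by
        rcases hz with h | h
        · exact Or.inr ((Rp_eq_neg_two_iff hp0 hp1 _).2 (by tauto))
        · exact Or.inl ((Rp_eq_zero_iff hp0 hp1 _).2 (by tauto))
      have hno : ¬ ∃ m < n, (Rp p)^[m] (Rp p z) = -1 + (1 - p) ∨
          (Rp p)^[m] (Rp p z) = -1 - (1 - p) := by
        rintro ⟨m, -, h⟩
        rcases hR with hR | hR <;> rw [hR] at h
        · rw [Function.iterate_fixed R0] at h
          rcases h with h | h <;> linarith
        · rw [Function.iterate_fixed R2] at h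
          rcases h with h | h <;> linarith
      simp only [hno, or_false]
      constructor
      · intro h
        rw [← h]
        tauto
      · intro h
        rcases hz with rfl | rfl <;> rcases h with h | h | h | h <;> linarith
    · push Not at hz
      refine ((fracEig_succ_iff hp0 hp1 n hz.1 hz.2).trans (ih (Rp p z))).trans ?_
      rw [Rp_eq_zero_iff hp0 hp1, Rp_eq_neg_two_iff hp0 hp1]
      simp only [hz.1, hz.2, false_or]
      generalize (∃ m < n, (Rp p)^[m] (Rp p z) = -1 + (1 - p) ∨
        (Rp p)^[m] (Rp p z) = -1 - (1 - p)) = P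
      constructor
      · rintro ((h | h) | (h | h) | h) <;> simp [h]
      · rintro (h | h | (h | h) | h) <;> simp [h]

theorem fractal_interval_laplacian_spectrum
    (p : ℝ) (hp0 : 0 < p) (hp1 : p < 1) :
    ∀ n : ℕ, 1 ≤ n →
      (∀ z : ℝ, fracEig p n z ↔
        (z = 0 ∨ z = -2 ∨ ∃ m < n, (Rp p)^[m] z = -1 + (1 - p) ∨ (Rp p)^[m] z = -1 - (1 - p))) ∧
      fracEig p n 0 ∧ fracEig p n (-2) ∧
      fracEig p n (-1 + (1 - p)) ∧ fracEig p n (-1 - (1 - p)) ∧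
      ((fracEig p n (-1 + p) ∧ fracEig p n (-1 - p)) ↔ p = 1 - p) := by
  intro n hn
  have spec := fracEig_iff hp0 hp1 n
  refine ⟨spec, (spec _).2 (Or.inl rfl), (spec _).2 (Or.inr (Or.inl rfl)),
    (spec _).2 (Or.inr (Or.inr ⟨0, hn, Or.inl rfl⟩)),
    (spec _).2 (Or.inr (Or.inr ⟨0, hn, Or.inr rfl⟩)), ?_⟩
  obtain ⟨n, rfl⟩ := Nat.exists_eq_add_of_le' hn
  rw [fracEig_succ_exceptional hp0 hp1 n (Or.inl rfl),
    fracEig_succ_exceptional hp0 hp1 n (Or.inr rfl), and_self]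
end
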